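/- Let H be an elementary abelian 2-hypergroup built from p involutions, p♯ of which are thick, and let G be a closed subset of H. Then the dimension of G equals 1 if O^ϑ(G) ≠ O_ϑ(G) = {e}, and equals r_2(G) otherwise. In particular, the dimension of H equals 1 if O^ϑ(H) ≠ O_ϑ(H) = {e}, and equals p − p♯ otherwise. -/

import Mathlib

namespace HyperPaper

/-- A hypergroup: hypermultiplication `hmul`, inversion `star`, identity `e`,
satisfying (H1) associativity, (H2) unique two-sided identity, (H3) exchange conditions. -/
structure Hypergroup (H : Type*) where
  hmul : H → H → Set H
  star : H → H
  e : H
  idl : ∀ p, hmul e p = {p}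
  idr : ∀ p, hmul p e = {p}
  e_unique : ∀ e' : H, (∀ p, hmul e' p = {p} ∧ hmul p e' = {p}) → e' = e
  assoc : ∀ p q r : H, (⋃ x ∈ hmul p q, hmul x r) = ⋃ x ∈ hmul q r, hmul p x
  h3l : ∀ p q r : H, p ∈ hmul q r ↔ q ∈ hmul p (star r)
  h3r : ∀ p q r : H, p ∈ hmul q r ↔ r ∈ hmul (star q) p

variable {H : Type*}

namespace Hypergroup

/-- Product of two subsets: FG = {a : ∃ b ∈ F, c ∈ G, a ∈ bc}. -/
def smul (hg : Hypergroup H) (F G : Set H) : Set H :=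
  {a | ∃ b ∈ F, ∃ c ∈ G, a ∈ hg.hmul b c}

/-- Closed subset: nonempty and G*G ⊆ G. -/
def IsClosed (hg : Hypergroup H) (G : Set H) : Prop :=
  G.Nonempty ∧ hg.smul (hg.star '' G) G ⊆ G

/-- Thin element: p*p = {e}. -/
def IsThin (hg : Hypergroup H) (p : H) : Prop := hg.hmul (hg.star p) p = {hg.e}

/-- Thick element: not thin. -/
def IsThick (hg : Hypergroup H) (p : H) : Prop := ¬ hg.IsThin p

/-- Involution: p ≠ e and {e, p} is closed. -/
def IsInvolution (hg : Hypergroup H) (p : H) : Prop :=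
  p ≠ hg.e ∧ hg.IsClosed {hg.e, p}

/-- ⟨G⟩: smallest closed subset containing G. -/
def gen (hg : Hypergroup H) (G : Set H) : Set H := ⋂₀ {C | hg.IsClosed C ∧ G ⊆ C}

/-- O_ϑ(G): the thin elements of H lying in G. -/
def Othin (hg : Hypergroup H) (G : Set H) : Set H := {p ∈ G | hg.IsThin p}

/-- F is a strongly normal closed subset of G: p*Fp ⊆ F ⊆ G for all p ∈ G. -/
def IsStronglyNormal (hg : Hypergroup H) (F G : Set H) : Prop :=
  hg.IsClosed F ∧ hg.IsClosed G ∧ F ⊆ G ∧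
    ∀ p ∈ G, hg.smul (hg.smul {hg.star p} F) {p} ⊆ F

/-- O^ϑ(G): intersection of all strongly normal closed subsets of ⟨G⟩. -/
def Osup (hg : Hypergroup H) (G : Set H) : Set H :=
  ⋂₀ {F | hg.IsStronglyNormal F (hg.gen G)}

/-- F is a normal closed subset of G. -/
def IsNormal (hg : Hypergroup H) (F G : Set H) : Prop :=
  hg.IsClosed F ∧ hg.IsClosed G ∧ F ⊆ G ∧ ∀ p ∈ G, hg.smul F {p} = hg.smul {p} F

/-- Product of a list of subsets (empty product is {e}). -/
def listProd (hg : Hypergroup H) : List (Set H) → Set H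
  | [] => {hg.e}
  | a :: l => hg.smul a (hg.listProd l)

/-- Product r_1 r_2 ⋯ r_n of a family of elements. -/
def famProd (hg : Hypergroup H) {n : ℕ} (r : Fin n → H) : Set H :=
  hg.listProd ((List.finRange n).map fun i => ({r i} : Set H))

/-- Ĝ_i: the product of the G_j with j ≠ i. -/
def cofactor (hg : Hypergroup H) {n : ℕ} (G : Fin n → Set H) (i : Fin n) : Set H :=
  hg.listProd (((List.finRange n).filter fun j => decide (j ≠ i)).map G)

/-- H is the direct product of the normal closed subsets G_1, …, G_n. -/
def IsDirectProduct (hg : Hypergroup H) {n : ℕ} (G : Fin n → Set H) : Prop :=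
  (∀ i, hg.IsNormal (G i) Set.univ) ∧
  (∀ i, hg.smul (G i) (hg.cofactor G i) = Set.univ) ∧
  (∀ i, G i ∩ hg.cofactor G i = {hg.e})

/-- r : Fin n → H is a decomposition of x with respect to the family G. -/
def IsDecomp (hg : Hypergroup H) {n : ℕ} (G : Fin n → Set H) (x : H) (r : Fin n → H) : Prop :=
  (∀ i, r i ∈ G i) ∧ x ∈ hg.famProd r

/-- The support of x: the elements ≠ e appearing in the decomposition of x. -/
def dsupport (hg : Hypergroup H) {n : ℕ} (G : Fin n → Set H) (x : H) : Set H :=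
  {y | y ≠ hg.e ∧ ∃ r, hg.IsDecomp G x r ∧ y ∈ Set.range r}

/-- The cover of x: the product r_1r_2⋯r_n for the decomposition of x. -/
def dcover (hg : Hypergroup H) {n : ℕ} (G : Fin n → Set H) (x : H) : Set H :=
  {y | ∃ r, hg.IsDecomp G x r ∧ y ∈ hg.famProd r}

/-- x is constrained: its cover equals {x}. -/
def IsConstrained (hg : Hypergroup H) {n : ℕ} (G : Fin n → Set H) (x : H) : Prop :=
  hg.dcover G x = {x}

/-- r_2(G): the largest 2-rank of a thin closed subset of H contained in G
(equivalently, the largest k such that G contains a thin symmetric closed subset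
of 2^k elements, which corresponds to an elementary abelian 2-group of 2-rank k). -/
noncomputable def rank2 (hg : Hypergroup H) (G : Set H) : ℕ :=
  sSup {k | ∃ U : Set H, hg.IsClosed U ∧ U ⊆ G ∧ (∀ u ∈ U, hg.IsThin u) ∧
    (∀ u ∈ U, hg.star u = u) ∧ U.ncard = 2 ^ k}

/-- F is a minimal generating subset of G. -/
def IsMinGen (hg : Hypergroup H) (G F : Set H) : Prop :=
  F ⊆ G ∧ hg.gen F = G ∧ ∀ p ∈ F, hg.gen (F \ {p}) ≠ G

/-- The dimension of G: the smallest cardinality of a minimal generating subset. -/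
noncomputable def dimension (hg : Hypergroup H) (G : Set H) : ℕ :=
  sInf {k | ∃ F : Set H, hg.IsMinGen G F ∧ F.Finite ∧ F.ncard = k}

/-- [F, G] = ⟨{a : ∃ b ∈ F, c ∈ G, a ∈ b*c*bc}⟩. -/
def commSet (hg : Hypergroup H) (F G : Set H) : Set H :=
  hg.gen {a | ∃ b ∈ F, ∃ c ∈ G,
    a ∈ hg.smul (hg.smul (hg.smul {hg.star b} {hg.star c}) {b}) {c}}

/-- derived G k = G^{(k+1)}: G^{(1)} = G, G^{(r)} = [G^{(r-1)}, G]. -/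
def derived (hg : Hypergroup H) (G : Set H) : ℕ → Set H
  | 0 => G
  | k + 1 => hg.commSet (hg.derived G k) G

/-- G is nilpotent: G^{(r)} = {e} for some r. -/
def IsNilpotent (hg : Hypergroup H) (G : Set H) : Prop :=
  ∃ k : ℕ, hg.derived G k = {hg.e}

/-- G is a residually thin closed subset: there is a chain {e} = F_1, …, F_n = G of
pairwise distinct closed subsets, each strongly normal in the next. -/
def IsResiduallyThin (hg : Hypergroup H) (G : Set H) : Prop :=
  ∃ (m : ℕ) (F : Fin (m + 1) → Set H), Function.Injective F ∧
    F 0 = {hg.e} ∧ F (Fin.last m) = G ∧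
    ∀ i : Fin m, hg.IsStronglyNormal (F i.castSucc) (F i.succ)

/-- x^k as a subset: x^0 = {e}, x^{k+1} = x^k · x. -/
def spow (hg : Hypergroup H) (x : H) : ℕ → Set H
  | 0 => {hg.e}
  | k + 1 => hg.smul (hg.spow x k) {x}

/-- F is a maximal closed subset of G. -/
def IsMaximalClosed (hg : Hypergroup H) (F G : Set H) : Prop :=
  hg.IsClosed F ∧ hg.IsClosed G ∧ F ⊆ G ∧ F ≠ G ∧
    ∀ E : Set H, hg.IsClosed E → F ⊆ E → E ⊆ G → E = F ∨ E = G

/-- The Frattini closed subset of G: the intersection (inside G) of all maximal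
closed subsets of G. -/
def frattini (hg : Hypergroup H) (G : Set H) : Set H :=
  G ∩ ⋂₀ {F | hg.IsMaximalClosed F G}

/-- α is an isomorphism from the closed subset F to the closed subset G. -/
def IsIso (hg : Hypergroup H) (F G : Set H) (α : H → H) : Prop :=
  Set.BijOn α F G ∧ α hg.e = hg.e ∧
    ∀ p ∈ F, ∀ q ∈ F, α '' hg.hmul p q = hg.hmul (α p) (α q)

/-- F ≃ G: there is an isomorphism from F to G. -/
def Isomorphic (hg : Hypergroup H) (F G : Set H) : Prop := ∃ α : H → H, hg.IsIso F G α

/-- Aut(G): the automorphism group of G, realized as the subgroup of permutations of G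
that fix e and preserve the hypermultiplication. -/
def autGroup (hg : Hypergroup H) (G : Set H) : Subgroup (Equiv.Perm G) where
  carrier := {σ | (∀ x : G, (x : H) = hg.e → ((σ x : H)) = hg.e) ∧
    ∀ p q x : G, (x : H) ∈ hg.hmul p q ↔ ((σ x : H)) ∈ hg.hmul (σ p) (σ q)}
  one_mem' := by
    constructor
    · intro x hx; simpa using hx
    · intro p q x; simp
  mul_mem' := by
    rintro σ τ ⟨he1, hm1⟩ ⟨he2, hm2⟩
    refine ⟨fun x hx => ?_, fun p q x => ?_⟩
    · simpa using he1 _ (he2 x hx)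
    · simpa using (hm2 p q x).trans (hm1 (τ p) (τ q) (τ x))
  inv_mem' := by
    rintro σ ⟨he, hm⟩
    refine ⟨fun x hx => ?_, fun p q x => ?_⟩
    · have h2 : σ x = x := Subtype.ext ((he x hx).trans hx.symm)
      have h3 : σ⁻¹ x = x := by
        conv_lhs => rw [← h2]
        simp
      rw [h3]; exact hx
    · have h := hm (σ⁻¹ p) (σ⁻¹ q) (σ⁻¹ x)
      simpa using h.symm

end Hypergroup

/-- An elementary abelian 2-hypergroup: a hypergroup that is the constrained direct
product of the closed subsets ⟨q_1⟩, …, ⟨q_n⟩ generated by involutions q_1, …, q_n. -/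
structure EA2Data (H : Type*) where
  hg : Hypergroup H
  n : ℕ
  q : Fin n → H
  invol : ∀ i, hg.IsInvolution (q i)
  dp : hg.IsDirectProduct fun i => hg.gen {q i}
  constrained : ∀ x : H, hg.IsConstrained (fun i => hg.gen {q i}) x

namespace EA2Data

/-- The family ⟨q_1⟩, …, ⟨q_n⟩. -/
def fam (E : EA2Data H) : Fin E.n → Set H := fun i => E.hg.gen {E.q i}

/-- The support of x. -/
def support (E : EA2Data H) (x : H) : Set H := E.hg.dsupport E.fam x

/-- Thick(F): externally thick elements of H lying in F. -/
def ThickIn (E : EA2Data H) (F : Set H) : Set H :=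
  {x ∈ F | x = E.hg.e ∨ ∀ y ∈ E.support x, E.hg.IsThick y}

/-- Thin(F): externally thin elements of H lying in F. -/
def ThinIn (E : EA2Data H) (F : Set H) : Set H :=
  {x ∈ F | x = E.hg.e ∨ ∀ y ∈ E.support x, E.hg.IsThin y}

/-- The (unique) pair (x⁺, x⁻) with x⁺ ∈ Thick(H), x⁻ ∈ Thin(H), x⁺x⁻ = {x}. -/
noncomputable def pm (E : EA2Data H) (x : H) : H × H :=
  @Classical.epsilon (H × H) ⟨(E.hg.e, E.hg.e)⟩ fun z =>
    z.1 ∈ E.ThickIn Set.univ ∧ z.2 ∈ E.ThinIn Set.univ ∧ E.hg.hmul z.1 z.2 = {x}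

/-- x⁺. -/
noncomputable def plus (E : EA2Data H) (x : H) : H := (E.pm x).1

/-- x⁻. -/
noncomputable def minus (E : EA2Data H) (x : H) : H := (E.pm x).2

/-- s(x): the number of thick elements of H in the support of x. -/
noncomputable def sElem (E : EA2Data H) (x : H) : ℕ :=
  {y ∈ E.support x | E.hg.IsThick y}.ncard

/-- s(G) = max {s(a) : a ∈ G}. -/
noncomputable def sSet (E : EA2Data H) (G : Set H) : ℕ :=
  sSup {k | ∃ a ∈ G, E.sElem a = k}

/-- x ⪯ y: the support of x is contained in the support of y. -/
def ple (E : EA2Data H) (x y : H) : Prop := E.support x ⊆ E.support y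

/-- p♯: the number of thick elements among q_1, …, q_n. -/
noncomputable def psharp (E : EA2Data H) : ℕ := {i : Fin E.n | E.hg.IsThick (E.q i)}.ncard

end EA2Data

/-- The Gaussian binomial coefficient C(n, k)_2 with base 2, via the
q-Pascal recurrence C(n, k)_2 = C(n-1, k-1)_2 + 2^k · C(n-1, k)_2. -/
def gaussBinom2 : ℕ → ℕ → ℕ
  | _, 0 => 1
  | 0, _ + 1 => 0
  | n + 1, k + 1 => gaussBinom2 n k + 2 ^ (k + 1) * gaussBinom2 n (k + 1)

end HyperPaper

namespace HyperPaper

namespace Hypergroup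

variable {H : Type*} (hg : Hypergroup H)

theorem e_mem_hmul_star (x : H) : hg.e ∈ hg.hmul x (hg.star x) := by
  rw [← hg.h3l, hg.idl]
  rfl

theorem e_mem_star_hmul (x : H) : hg.e ∈ hg.hmul (hg.star x) x := by
  rw [← hg.h3r, hg.idr]
  rfl

theorem star_star (x : H) : hg.star (hg.star x) = x := by
  have h := (hg.h3r _ _ _).1 (hg.e_mem_star_hmul x)
  rw [hg.idr] at h
  exact h.symm

theorem star_e : hg.star hg.e = hg.e := by
  have h := hg.e_mem_star_hmul hg.e
  rw [hg.idr] at h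
  exact h.symm

theorem eq_star_of_e_mem {x y : H} (h : hg.e ∈ hg.hmul x y) : y = hg.star x := by
  have h' := (hg.h3r _ _ _).1 h
  rwa [hg.idr] at h'

namespace IsClosed

variable {hg} {C : Set H}

theorem star_mul_mem (hC : hg.IsClosed C) {x y z : H} (hx : x ∈ C) (hy : y ∈ C)
    (hz : z ∈ hg.hmul (hg.star x) y) : z ∈ C :=
  hC.2 ⟨hg.star x, ⟨x, hx, rfl⟩, y, hy, hz⟩

theorem e_mem (hC : hg.IsClosed C) : hg.e ∈ C := by
  obtain ⟨x, hx⟩ := hC.1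
  exact hC.star_mul_mem hx hx (hg.e_mem_star_hmul x)

theorem star_mem (hC : hg.IsClosed C) {x : H} (hx : x ∈ C) : hg.star x ∈ C :=
  hC.star_mul_mem hx hC.e_mem (by rw [hg.idr]; rfl)

theorem mul_mem (hC : hg.IsClosed C) {x y z : H} (hx : x ∈ C) (hy : y ∈ C)
    (hz : z ∈ hg.hmul x y) : z ∈ C :=
  hC.star_mul_mem (hC.star_mem hx) hy (by rwa [hg.star_star])

end IsClosed

theorem isClosed_gen (F : Set H) : hg.IsClosed (hg.gen F) := by
  refine ⟨⟨hg.e, fun C hC => hC.1.e_mem⟩, ?_⟩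
  rintro z ⟨_, ⟨x, hx, rfl⟩, y, hy, hz⟩ C hC
  exact hC.1.star_mul_mem (hx C hC) (hy C hC) hz

theorem subset_gen (F : Set H) : F ⊆ hg.gen F := fun _ hx _ hC => hC.2 hx

theorem gen_subset {F C : Set H} (hC : hg.IsClosed C) (h : F ⊆ C) : hg.gen F ⊆ C :=
  fun _ hx => hx C ⟨hC, h⟩

theorem gen_eq_self {C : Set H} (hC : hg.IsClosed C) : hg.gen C = C :=
  (hg.gen_subset hC subset_rfl).antisymm (hg.subset_gen C)

theorem smul_singleton (x y : H) : hg.smul {x} {y} = hg.hmul x y := by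
  ext z
  simp [smul]

theorem smul_assoc (A B C : Set H) : hg.smul (hg.smul A B) C = hg.smul A (hg.smul B C) := by
  ext z
  have key := fun a b c => Set.ext_iff.1 (hg.assoc a b c) z
  simp only [Set.mem_iUnion, exists_prop] at key
  constructor
  · rintro ⟨x, ⟨a, ha, b, hb, hx⟩, c, hc, hz⟩
    obtain ⟨y, hy, hz'⟩ := (key a b c).1 ⟨x, hx, hz⟩
    exact ⟨a, ha, y, ⟨b, hb, c, hc, hy⟩, hz'⟩
  · rintro ⟨a, ha, y, ⟨b, hb, c, hc, hy⟩, hz⟩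
    obtain ⟨x, hx, hz'⟩ := (key a b c).2 ⟨y, hy, hz⟩
    exact ⟨x, ⟨a, ha, b, hb, hx⟩, c, hc, hz'⟩

theorem e_smul (A : Set H) : hg.smul {hg.e} A = A := by
  ext z
  simp [smul, hg.idl]

theorem smul_e (A : Set H) : hg.smul A {hg.e} = A := by
  ext z
  simp [smul, hg.idr]

theorem hmul_nonempty (x y : H) : (hg.hmul x y).Nonempty := by
  have h : x ∈ hg.smul {x} (hg.hmul y (hg.star y)) :=
    ⟨x, rfl, hg.e, hg.e_mem_hmul_star y, by rw [hg.idr]; rfl⟩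
  rw [← smul_singleton, ← smul_assoc, smul_singleton] at h
  obtain ⟨z, hz, -⟩ := h
  exact ⟨z, hz⟩

/-- The complex product turns the subsets of a hypergroup into a monoid. -/
abbrev setMonoid : Monoid (Set H) where
  mul := hg.smul
  one := {hg.e}
  mul_assoc := hg.smul_assoc
  one_mul := hg.e_smul
  mul_one := hg.smul_e

theorem smul_comm (hc : ∀ x y, hg.hmul x y = hg.hmul y x) (A B : Set H) :
    hg.smul A B = hg.smul B A := by
  ext z
  constructor <;>
  · rintro ⟨x, hx, y, hy, hz⟩
    exact ⟨y, hy, x, hx, by rwa [hc]⟩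

/-- The subsets of a commutative hypergroup form a commutative monoid. -/
abbrev setCommMonoid (hc : ∀ x y, hg.hmul x y = hg.hmul y x) : CommMonoid (Set H) :=
  { hg.setMonoid with mul_comm := hg.smul_comm hc }

theorem listProd_eq_prod (l : List (Set H)) :
    letI := hg.setMonoid
    hg.listProd l = l.prod := by
  let _ := hg.setMonoid
  induction l with
  | nil => rfl
  | cons a l ih => rw [List.prod_cons, ← ih]; rfl

theorem subset_listProd {l : List (Set H)} (he : ∀ F ∈ l, hg.e ∈ F) {F : Set H} (hF : F ∈ l) :
    F ⊆ hg.listProd l := by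
  have e_mem : ∀ {l : List (Set H)}, (∀ F ∈ l, hg.e ∈ F) → hg.e ∈ hg.listProd l := by
    intro l
    induction l with
    | nil => intro _; rfl
    | cons a l ih =>
      intro h
      exact ⟨hg.e, h a (by simp), hg.e, ih fun F hF => h F (by simp [hF]), by rw [hg.idl]; rfl⟩
  induction l with
  | nil => simp at hF
  | cons a l ih =>
    have hl : ∀ F ∈ l, hg.e ∈ F := fun F hF => he F (by simp [hF])
    intro x hx
    rcases List.mem_cons.1 hF with rfl | hF
    · exact ⟨x, hx, hg.e, e_mem hl, by rw [hg.idr]; rfl⟩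
    · exact ⟨hg.e, he a (by simp), x, ih hl hF hx, by rw [hg.idl]; rfl⟩

section Comm

variable (hc : ∀ x y, hg.hmul x y = hg.hmul y x)

theorem mem_prod_iff {ι : Type*} (s : Finset ι) (F : ι → Set H) (x : H) :
    letI := hg.setCommMonoid hc
    x ∈ ∏ i ∈ s, F i ↔ ∃ r : ι → H, (∀ i ∈ s, r i ∈ F i) ∧ x ∈ ∏ i ∈ s, ({r i} : Set H) := by
  classical
  let _ := hg.setCommMonoid hc
  show x ∈ ∏ i ∈ s, F i ↔ ∃ r : ι → H, (∀ i ∈ s, r i ∈ F i) ∧ x ∈ ∏ i ∈ s, ({r i} : Set H)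
  induction s using Finset.induction_on generalizing x with
  | empty => exact ⟨fun h => ⟨fun _ => hg.e, by simp, h⟩, fun ⟨_, _, h⟩ => h⟩
  | insert a s ha ih =>
    rw [Finset.prod_insert ha]
    constructor
    · rintro ⟨y, hy, z, hz, hx⟩
      obtain ⟨r, hr, hz⟩ := (ih z).1 hz
      refine ⟨Function.update r a y, ?_, ?_⟩
      · intro i hi
        by_cases h : i = a
        · subst h; simpa using hy
        · simpa [h] using hr i (by simpa [h] using hi)
      · rw [Finset.prod_insert ha]
        refine ⟨y, by simp, z, ?_, hx⟩
        rwa [Finset.prod_congr rfl fun i hi => ?_]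
        rw [Function.update_of_ne (ne_of_mem_of_not_mem hi ha)]
    · rintro ⟨r, hr, hx⟩
      rw [Finset.prod_insert ha] at hx
      obtain ⟨y, hy, z, hz, hx⟩ := hx
      obtain rfl : y = r a := hy
      exact ⟨r a, hr a (by simp), z, (ih z).2 ⟨r, fun i hi => hr i (by simp [hi]), hz⟩, hx⟩

theorem prod_nonempty {ι : Type*} (s : Finset ι) (r : ι → H) :
    letI := hg.setCommMonoid hc
    (∏ i ∈ s, ({r i} : Set H)).Nonempty := by
  classical
  let _ := hg.setCommMonoid hc
  show (∏ i ∈ s, ({r i} : Set H)).Nonempty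
  induction s using Finset.induction_on with
  | empty => exact ⟨hg.e, rfl⟩
  | insert a s ha ih =>
    rw [Finset.prod_insert ha]
    obtain ⟨z, hz⟩ := ih
    obtain ⟨x, hx⟩ := hg.hmul_nonempty (r a) z
    exact ⟨x, r a, rfl, z, hz, hx⟩

theorem famProd_eq_prod {n : ℕ} (r : Fin n → H) :
    letI := hg.setCommMonoid hc
    hg.famProd r = ∏ i, ({r i} : Set H) := by
  let _ := hg.setCommMonoid hc
  exact (hg.listProd_eq_prod _).trans (Fin.prod_univ_def _).symm

theorem cofactor_eq_prod {n : ℕ} (G : Fin n → Set H) (i : Fin n) :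
    letI := hg.setCommMonoid hc
    hg.cofactor G i = ∏ j ∈ Finset.univ.erase i, G j := by
  let _ := hg.setCommMonoid hc
  refine (hg.listProd_eq_prod _).trans ?_
  refine (List.prod_toFinset G ((List.nodup_finRange n).filter _)).symm.trans ?_
  refine Finset.prod_congr ?_ fun _ _ => rfl
  ext j
  simp

end Comm

/-- Coordinates on a hypergroup: an element is a vector over `ZMod 2` together with a set of
thick directions; vectors add, while in a thick direction the product of `1` with itself takes
both values. -/
structure Coordinates {H : Type*} (hg : Hypergroup H) (V K : Type*) [AddCommGroup V] where
  equiv : H ≃ V × Set K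
  mem_hmul : ∀ x y z, z ∈ hg.hmul x y ↔ (equiv z).1 = (equiv x).1 + (equiv y).1 ∧
    (∀ k ∈ (equiv z).2, k ∈ (equiv x).2 ∨ k ∈ (equiv y).2) ∧
    (∀ k ∈ (equiv x).2, k ∈ (equiv y).2 ∨ k ∈ (equiv z).2) ∧
    ∀ k ∈ (equiv y).2, k ∈ (equiv x).2 ∨ k ∈ (equiv z).2

namespace Coordinates

variable {H V K : Type*} {hg : Hypergroup H} [AddCommGroup V] (c : hg.Coordinates V K)

/-- The vector of an element. -/
def vec (x : H) : V := (c.equiv x).1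

/-- The thick directions of an element. -/
def dirs (x : H) : Set K := (c.equiv x).2

/-- The element with given coordinates. -/
def elt (v : V) (A : Set K) : H := c.equiv.symm (v, A)

@[simp] theorem vec_elt (v : V) (A : Set K) : c.vec (c.elt v A) = v := by simp [vec, elt]

@[simp] theorem dirs_elt (v : V) (A : Set K) : c.dirs (c.elt v A) = A := by simp [dirs, elt]

@[simp] theorem elt_vec_dirs (x : H) : c.elt (c.vec x) (c.dirs x) = x := by simp [vec, dirs, elt]

theorem mem_hmul_iff (x y z : H) : z ∈ hg.hmul x y ↔ c.vec z = c.vec x + c.vec y ∧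
    (∀ k ∈ c.dirs z, k ∈ c.dirs x ∨ k ∈ c.dirs y) ∧
    (∀ k ∈ c.dirs x, k ∈ c.dirs y ∨ k ∈ c.dirs z) ∧
    ∀ k ∈ c.dirs y, k ∈ c.dirs x ∨ k ∈ c.dirs z :=
  c.mem_hmul x y z

@[simp] theorem vec_e : c.vec hg.e = 0 := by
  have h : hg.e ∈ hg.hmul hg.e hg.e := by rw [hg.idl]; rfl
  simpa using ((c.mem_hmul_iff _ _ _).1 h).1

theorem e_eq : hg.e = c.elt 0 ∅ := by
  have h : c.elt 0 ∅ ∈ hg.hmul hg.e hg.e := by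
    simp +contextual [c.mem_hmul_iff]
  rw [hg.idl] at h
  exact h.symm

@[simp] theorem dirs_e : c.dirs hg.e = ∅ := by simp [c.e_eq]

variable [Module (ZMod 2) V]

theorem star_eq (c : hg.Coordinates V K) (x : H) : hg.star x = x :=
  (hg.eq_star_of_e_mem (x := x)
    (by simp +contextual [c.mem_hmul_iff, ZModModule.add_self])).symm

theorem isThin_iff (x : H) : hg.IsThin x ↔ c.dirs x = ∅ := by
  rw [IsThin, c.star_eq]
  constructor
  · intro h
    have h' : c.elt 0 (c.dirs x) ∈ hg.hmul x x := by
      simp +contextual [c.mem_hmul_iff, ZModModule.add_self]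
    rw [h] at h'
    have h'' := congrArg c.dirs (show c.elt 0 (c.dirs x) = hg.e from h')
    simpa using h''
  · intro h
    ext z
    rw [c.mem_hmul_iff, h, ZModModule.add_self, Set.mem_singleton_iff]
    constructor
    · rintro ⟨h1, h2, -⟩
      rw [← c.elt_vec_dirs z, h1, c.e_eq]
      congr 1
      exact Set.eq_empty_of_forall_notMem fun k hk => by simpa using h2 k hk
    · rintro rfl
      simp

/-- The closed subset with a given space of vectors and a given set of thick directions. -/
def box (W : Submodule (ZMod 2) V) (M : Set K) : Set H := {x | c.vec x ∈ W ∧ c.dirs x ⊆ M}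

theorem isClosed_box (W : Submodule (ZMod 2) V) (M : Set K) : hg.IsClosed (c.box W M) := by
  refine ⟨⟨hg.e, by simp [box]⟩, ?_⟩
  rintro z ⟨_, ⟨x, hx, rfl⟩, y, hy, hz⟩
  rw [c.star_eq, c.mem_hmul_iff] at hz
  refine ⟨hz.1 ▸ W.add_mem hx.1 hy.1, fun k hk => ?_⟩
  rcases hz.2.1 k hk with h | h
  exacts [hx.2 h, hy.2 h]

theorem box_subset_box_iff {W W' : Submodule (ZMod 2) V} {M M' : Set K} :
    c.box W M ⊆ c.box W' M' ↔ W ≤ W' ∧ M ⊆ M' := by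
  constructor
  · intro h
    constructor
    · intro v hv
      simpa using (h (show c.elt v ∅ ∈ c.box W M by simp [box, hv])).1
    · simpa using (h (show c.elt 0 M ∈ c.box W M by simp [box])).2
  · rintro ⟨h1, h2⟩ x ⟨hx1, hx2⟩
    exact ⟨h1 hx1, hx2.trans h2⟩

theorem box_inj {W W' : Submodule (ZMod 2) V} {M M' : Set K} :
    c.box W M = c.box W' M' ↔ W = W' ∧ M = M' := by
  simp only [c.box_subset_box_iff, le_antisymm_iff]
  tauto

theorem box_univ : c.box ⊤ Set.univ = Set.univ := by simp [box]

theorem box_bot_empty : c.box ⊥ ∅ = {hg.e} := by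
  ext x
  simp only [box, Submodule.mem_bot, Set.subset_empty_iff, Set.mem_ofPred_eq,
    Set.mem_singleton_iff]
  constructor
  · rintro ⟨h1, h2⟩
    rw [← c.elt_vec_dirs x, h1, h2, c.e_eq]
  · rintro rfl
    simp

theorem exists_eq_box [Finite K] {C : Set H} (hC : hg.IsClosed C) :
    ∃ W M, C = c.box W M := by
  let W : Submodule (ZMod 2) V := AddSubgroup.toZModSubmodule 2
    { carrier := {v | c.elt v ∅ ∈ C}
      zero_mem' := by simpa [c.e_eq] using hC.e_mem
      add_mem' := fun {a b} ha hb => hC.mul_mem ha hb (by simp [c.mem_hmul_iff])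
      neg_mem' := fun {a} ha => by simpa [ZModModule.neg_eq_self] using ha }
  have mem_W : ∀ v, v ∈ W ↔ c.elt v ∅ ∈ C := fun v => Iff.rfl
  have sub : ∀ x ∈ C, ∀ A ⊆ c.dirs x, c.elt 0 A ∈ C := fun x hx A hA =>
    hC.mul_mem hx hx (by
      rw [c.mem_hmul_iff]
      simp +contextual [ZModModule.add_self]
      exact fun k hk => hA hk)
  refine ⟨W, {k | c.elt 0 {k} ∈ C}, Set.ext fun x => ⟨fun hx => ⟨?_, fun k hk => ?_⟩, ?_⟩⟩
  · exact (mem_W _).2 (hC.mul_mem hx (sub x hx _ subset_rfl)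
      (by simp +contextual [c.mem_hmul_iff]))
  · exact sub x hx {k} (by simpa using hk)
  · rintro ⟨h1, h2⟩
    have key : ∀ A : Set K, A ⊆ {k | c.elt 0 {k} ∈ C} → c.elt 0 A ∈ C := by
      intro A
      induction A, A.toFinite using Set.Finite.induction_on with
      | empty => intro _; simpa [c.e_eq] using hC.e_mem
      | @insert k A _ _ ih =>
        intro h
        rw [Set.insert_subset_iff] at h
        exact hC.mul_mem h.1 (ih h.2) (by simp +contextual [c.mem_hmul_iff])
    exact hC.mul_mem ((mem_W _).1 h1) (key _ h2) (by simp +contextual [c.mem_hmul_iff])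

theorem gen_eq_box [Finite K] (F : Set H) :
    hg.gen F = c.box (Submodule.span (ZMod 2) (c.vec '' F)) (⋃ x ∈ F, c.dirs x) := by
  apply Set.Subset.antisymm
  · apply hg.gen_subset (c.isClosed_box _ _)
    exact fun x hx => ⟨Submodule.subset_span ⟨x, hx, rfl⟩, Set.subset_biUnion_of_mem hx⟩
  · obtain ⟨W, M, h⟩ := c.exists_eq_box (hg.isClosed_gen F)
    have hF := hg.subset_gen F
    rw [h] at hF ⊢
    rw [box_subset_box_iff, Submodule.span_le, Set.image_subset_iff, Set.iUnion₂_subset_iff]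
    exact ⟨fun x hx => (hF hx).1, fun x hx => (hF hx).2⟩

theorem Othin_box (W : Submodule (ZMod 2) V) (M : Set K) :
    hg.Othin (c.box W M) = c.box W ∅ := by
  ext x
  simp only [Othin, c.isThin_iff, box, Set.mem_ofPred_eq, Set.subset_empty_iff]
  constructor
  · exact fun h => ⟨h.1.1, h.2⟩
  · exact fun h => ⟨⟨h.1, by simp [h.2]⟩, h.2⟩

theorem Osup_box [Finite K] (W : Submodule (ZMod 2) V) (M : Set K) :
    hg.Osup (c.box W M) = c.box ⊥ M := by
  rw [Osup, hg.gen_eq_self (c.isClosed_box W M)]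
  apply Set.Subset.antisymm
  · apply Set.sInter_subset_of_mem
    refine ⟨c.isClosed_box _ _, c.isClosed_box _ _,
      c.box_subset_box_iff.2 ⟨bot_le, subset_rfl⟩, ?_⟩
    rintro p hp z ⟨w, ⟨_, rfl, f, hf, hw⟩, _, rfl, hz⟩
    have hw' := (c.mem_hmul_iff _ _ _).1 hw
    have hz' := (c.mem_hmul_iff _ _ _).1 hz
    rw [c.star_eq] at hw'
    have hf0 : c.vec f = 0 := by simpa using hf.1
    constructor
    · rw [hz'.1, hw'.1, hf0, add_zero, ZModModule.add_self]
      exact Submodule.zero_mem _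
    · intro k hk
      rcases hz'.2.1 k hk with h | h
      · rcases hw'.2.1 k h with h | h
        exacts [hp.2 h, hf.2 h]
      · exact hp.2 h
  · apply Set.subset_sInter
    rintro F ⟨hF, -, -, h⟩
    obtain ⟨W', M', rfl⟩ := c.exists_eq_box hF
    rw [box_subset_box_iff]
    refine ⟨bot_le, ?_⟩
    have hM := h (c.elt 0 M) (by simp [box])
    have : c.elt 0 M ∈ c.box W' M' := hM (by
      refine ⟨c.elt 0 M, ⟨_, rfl, hg.e, hF.e_mem, ?_⟩, _, rfl, ?_⟩
      · rw [c.star_eq, hg.idr]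
        rfl
      · simp +contextual [c.mem_hmul_iff])
    simpa using this.2

theorem Osup_ne_and_Othin_eq_iff [Finite K] (W : Submodule (ZMod 2) V) (M : Set K) :
    (hg.Osup (c.box W M) ≠ hg.Othin (c.box W M) ∧ hg.Othin (c.box W M) = {hg.e}) ↔
      W = ⊥ ∧ M ≠ ∅ := by
  rw [Osup_box, Othin_box, ← c.box_bot_empty, ne_eq, box_inj, box_inj]
  constructor
  · rintro ⟨h, rfl, -⟩
    exact ⟨rfl, fun hM => h ⟨rfl, hM⟩⟩
  · rintro ⟨rfl, h⟩
    exact ⟨fun h' => h h'.2, rfl, rfl⟩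

theorem ncard_box_empty [FiniteDimensional (ZMod 2) V] (W : Submodule (ZMod 2) V) :
    (c.box W ∅).ncard = 2 ^ Module.finrank (ZMod 2) W := by
  have h : c.box W ∅ = (fun v => c.elt v ∅) '' (W : Set V) := by
    ext x
    simp only [box, Set.subset_empty_iff, Set.mem_ofPred_eq, Set.mem_image, SetLike.mem_coe]
    constructor
    · rintro ⟨h1, h2⟩
      exact ⟨_, h1, by rw [← h2, elt_vec_dirs]⟩
    · rintro ⟨v, hv, rfl⟩
      simpa using hv
  rw [h, Set.ncard_image_of_injective _ fun v w hvw => by simpa using congrArg c.vec hvw]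
  have := Module.natCard_eq_pow_finrank (K := ZMod 2) (V := W)
  rw [Nat.card_zmod] at this
  exact this

theorem rank2_box [Finite K] [FiniteDimensional (ZMod 2) V] (W : Submodule (ZMod 2) V)
    (M : Set K) : hg.rank2 (c.box W M) = Module.finrank (ZMod 2) W := by
  apply IsGreatest.csSup_eq
  constructor
  · refine ⟨c.box W ∅, c.isClosed_box _ _, c.box_subset_box_iff.2 ⟨le_rfl, by simp⟩,
      fun x hx => ?_, fun x _ => c.star_eq x, c.ncard_box_empty W⟩
    rw [c.isThin_iff]
    exact Set.subset_empty_iff.1 hx.2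
  · rintro k ⟨U, hU, hUG, hthin, -, hcard⟩
    obtain ⟨W', M', rfl⟩ := c.exists_eq_box hU
    have hM' : M' = ∅ := by
      simpa [c.isThin_iff] using hthin (c.elt 0 M') (by simp [box])
    subst hM'
    rw [ncard_box_empty] at hcard
    rw [← Nat.pow_right_injective le_rfl hcard]
    exact Submodule.finrank_mono (c.box_subset_box_iff.1 hUG).1

theorem finrank_le_ncard [Finite K] {W : Submodule (ZMod 2) V} {M : Set K} {F : Set H}
    (hF : F.Finite) (h : hg.gen F = c.box W M) : Module.finrank (ZMod 2) W ≤ F.ncard := by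
  rw [c.gen_eq_box, box_inj] at h
  rw [← h.1]
  have := (hF.image c.vec).fintype
  calc _ ≤ (c.vec '' F).toFinset.card := finrank_span_le_card _
    _ = (c.vec '' F).ncard := (Set.ncard_eq_toFinset_card' _).symm
    _ ≤ F.ncard := Set.ncard_image_le hF

theorem dimension_box_of_bot [Finite K] {M : Set K} (hM : M ≠ ∅) :
    hg.dimension (c.box ⊥ M) = 1 := by
  have empty_ne : hg.gen ∅ ≠ c.box ⊥ M := by
    rw [c.gen_eq_box, ne_eq, box_inj]
    simpa using hM.symm
  apply IsLeast.csInf_eq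
  constructor
  · refine ⟨{c.elt 0 M}, ⟨by simp [box], ?_, ?_⟩, Set.finite_singleton _, Set.ncard_singleton _⟩
    · rw [c.gen_eq_box, box_inj]
      simp
    · rintro p rfl
      simpa using empty_ne
  · rintro k ⟨F, hF, hfin, rfl⟩
    rw [Nat.one_le_iff_ne_zero, ne_eq, Set.ncard_eq_zero hfin]
    rintro rfl
    exact empty_ne hF.2.1

theorem dimension_box [Finite K] [FiniteDimensional (ZMod 2) V] {W : Submodule (ZMod 2) V}
    {M : Set K} (h : ¬(W = ⊥ ∧ M ≠ ∅)) :
    hg.dimension (c.box W M) = Module.finrank (ZMod 2) W := by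
  apply IsLeast.csInf_eq
  constructor
  · let b := Module.finBasis (ZMod 2) W
    let F : Set H := Set.range fun i => c.elt (b i) M
    have hfin : F.Finite := Set.finite_range _
    have hgen : hg.gen F = c.box W M := by
      rw [c.gen_eq_box, box_inj]
      constructor
      · have hb : c.vec '' F = W.subtype '' Set.range b := by
          simp only [F, ← Set.range_comp]
          congr 1
          ext i
          simp
        rw [hb, Submodule.span_image, b.span_eq, Submodule.map_top, Submodule.range_subtype]
      · rcases M.eq_empty_or_nonempty with rfl | hM
        · simp [F]
        · have hW : W ≠ ⊥ := fun hW => h ⟨hW, hM.ne_empty⟩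
          have : Nonempty (Fin (Module.finrank (ZMod 2) W)) := by
            rw [← Fin.pos_iff_nonempty, Nat.pos_iff_ne_zero, ne_eq, Submodule.finrank_eq_zero]
            exact hW
          simp [F, Set.iUnion_const]
    have hcard : F.ncard = Module.finrank (ZMod 2) W := by
      refine le_antisymm ?_ (c.finrank_le_ncard hfin hgen)
      have := Set.ncard_image_le (f := fun i => c.elt (b i : V) M) Set.finite_univ
      rwa [Set.image_univ, Set.ncard_univ, Nat.card_fin] at this
    refine ⟨F, ⟨hgen ▸ hg.subset_gen F, hgen, fun p hp hgen' => ?_⟩, hfin, hcard⟩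
    have h1 := c.finrank_le_ncard hfin.sdiff hgen'
    have h2 := Set.ncard_sdiff_singleton_lt_of_mem hp hfin
    omega
  · rintro k ⟨F, hF, hfin, rfl⟩
    exact c.finrank_le_ncard hfin hF.2.1

end Coordinates

end Hypergroup

theorem zmod_two_eq_zero_or_one : ∀ t : ZMod 2, t = 0 ∨ t = 1 := by decide

namespace EA2Data

open Hypergroup

variable {H : Type*} (E : EA2Data H)

theorem gen_q (i : Fin E.n) : E.hg.gen {E.q i} = {E.hg.e, E.q i} := by
  apply (E.hg.gen_subset (E.invol i).2 (by simp)).antisymm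
  rintro x (rfl | rfl)
  exacts [(E.hg.isClosed_gen _).e_mem, E.hg.subset_gen _ rfl]

theorem star_q (i : Fin E.n) : E.hg.star (E.q i) = E.q i := by
  rcases (E.invol i).2.star_mem (show E.q i ∈ _ by simp) with h | h
  · exact absurd (by rw [← E.hg.star_star (E.q i), h, star_e]) (E.invol i).1
  · exact h

theorem isNormal_q (i : Fin E.n) : E.hg.IsNormal {E.hg.e, E.q i} Set.univ := by
  rw [← gen_q]
  exact E.dp.1 i

theorem inter_cofactor (i : Fin E.n) :
    E.hg.gen {E.q i} ∩ E.hg.cofactor (fun i => E.hg.gen {E.q i}) i = {E.hg.e} := E.dp.2.2 i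

theorem q_notMem_hmul {i j : Fin E.n} (h : i ≠ j) : E.q j ∉ E.hg.hmul (E.q i) (E.q j) := by
  intro hj
  rw [E.hg.h3l] at hj
  have hcl := E.hg.isClosed_gen {E.q j}
  have hqj := E.hg.subset_gen {E.q j} rfl
  have hi : E.q i ∈ E.hg.gen {E.q j} := hcl.mul_mem hqj (hcl.star_mem hqj) hj
  refine (E.invol i).1 ((E.inter_cofactor i).subset ⟨E.hg.subset_gen _ rfl, ?_⟩)
  refine E.hg.subset_listProd ?_ ?_ hi
  · intro F hF
    obtain ⟨k, -, rfl⟩ := List.mem_map.1 hF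
    exact (E.hg.isClosed_gen _).e_mem
  · exact List.mem_map.2 ⟨j, by simp [h.symm], rfl⟩

theorem hmul_q_subset {i j : Fin E.n} (h : i ≠ j) :
    E.hg.hmul (E.q i) (E.q j) ⊆ E.hg.hmul (E.q j) (E.q i) := by
  intro z hz
  have hz' : z ∈ E.hg.smul {E.hg.e, E.q i} {E.q j} := ⟨_, by simp, _, rfl, hz⟩
  rw [(E.isNormal_q i).2.2.2 _ (Set.mem_univ _)] at hz'
  obtain ⟨_, rfl, y, rfl | rfl, hy⟩ := hz'
  · rw [E.hg.idr] at hy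
    obtain rfl : z = E.q j := hy
    exact absurd hz (E.q_notMem_hmul h)
  · exact hy

theorem hmul_q_comm (i j : Fin E.n) :
    E.hg.hmul (E.q i) (E.q j) = E.hg.hmul (E.q j) (E.q i) := by
  rcases eq_or_ne i j with rfl | h
  exacts [rfl, (E.hmul_q_subset h).antisymm (E.hmul_q_subset h.symm)]

theorem famProd_eq_singleton {r : Fin E.n → H} (hr : ∀ i, r i ∈ E.hg.gen {E.q i}) {x : H}
    (hx : x ∈ E.hg.famProd r) : E.hg.famProd r = {x} := by
  apply Set.Subset.antisymm _ (Set.singleton_subset_iff.2 hx)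
  rw [← E.constrained x]
  exact fun y hy => ⟨r, ⟨hr, hx⟩, hy⟩

theorem exists_famProd_eq (x : H) :
    ∃ r : Fin E.n → H, (∀ i, r i ∈ E.hg.gen {E.q i}) ∧ E.hg.famProd r = {x} := by
  obtain ⟨r, hr, hx⟩ := (E.constrained x).symm.subset rfl
  exact ⟨r, hr.1, E.famProd_eq_singleton hr.1 hx⟩

theorem hmul_comm (x y : H) : E.hg.hmul x y = E.hg.hmul y x := by
  let _ := E.hg.setMonoid
  obtain ⟨r, hr, hx⟩ := E.exists_famProd_eq x
  obtain ⟨s, hs, hy⟩ := E.exists_famProd_eq y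
  rw [← E.hg.smul_singleton x, ← E.hg.smul_singleton y, ← hx, ← hy]
  have key : Commute (E.hg.famProd r) (E.hg.famProd s) := by
    rw [famProd, famProd, listProd_eq_prod, listProd_eq_prod]
    refine Commute.list_prod_left _ _ fun A hA => Commute.list_prod_right _ _ fun B hB => ?_
    obtain ⟨i, -, rfl⟩ := List.mem_map.1 hA
    obtain ⟨j, -, rfl⟩ := List.mem_map.1 hB
    have hri := hr i
    have hsj := hs j
    rw [gen_q] at hri hsj
    rcases hri with h | h
    · rw [h]
      exact Commute.one_left _
    rcases hsj with h' | h'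
    · rw [h']
      exact Commute.one_right _
    rw [show r i = E.q i from h, show s j = E.q j from h']
    refine (E.hg.smul_singleton _ _).trans ?_
    rw [E.hmul_q_comm]
    exact (E.hg.smul_singleton _ _).symm
  exact key

theorem star_of_mem_gen {i : Fin E.n} {x : H} (hx : x ∈ E.hg.gen {E.q i}) :
    E.hg.star x = x := by
  rw [gen_q] at hx
  rcases hx with rfl | rfl
  exacts [E.hg.star_e, E.star_q i]

theorem star_eq (x : H) : E.hg.star x = x := by
  let _ := E.hg.setCommMonoid E.hmul_comm
  obtain ⟨r, hr, hx⟩ := E.exists_famProd_eq x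
  symm
  apply E.hg.eq_star_of_e_mem
  rw [← smul_singleton, ← hx, E.hg.famProd_eq_prod E.hmul_comm]
  change E.hg.e ∈ (∏ i, ({r i} : Set H)) * ∏ i, ({r i} : Set H)
  rw [← Finset.prod_mul_distrib, E.hg.mem_prod_iff E.hmul_comm]
  refine ⟨fun _ => E.hg.e, fun i _ => ⟨r i, rfl, r i, rfl, ?_⟩, ?_⟩
  · have h := E.hg.e_mem_hmul_star (r i)
    rwa [E.star_of_mem_gen (hr i)] at h
  · have h : ∏ i : Fin E.n, ({E.hg.e} : Set H) = {E.hg.e} := Finset.prod_const_one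
    rw [h]
    rfl

theorem gen_smul_gen (i : Fin E.n) :
    E.hg.smul (E.hg.gen {E.q i}) (E.hg.gen {E.q i}) = E.hg.gen {E.q i} := by
  have hcl := E.hg.isClosed_gen {E.q i}
  apply Set.Subset.antisymm
  · rintro z ⟨x, hx, y, hy, hz⟩
    exact hcl.mul_mem hx hy hz
  · intro z hz
    exact ⟨z, hz, E.hg.e, hcl.e_mem, by rw [E.hg.idr]; rfl⟩

theorem cofactor_smul_cofactor (i : Fin E.n) :
    E.hg.smul (E.hg.cofactor (fun i => E.hg.gen {E.q i}) i)
      (E.hg.cofactor (fun i => E.hg.gen {E.q i}) i) =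
      E.hg.cofactor (fun i => E.hg.gen {E.q i}) i := by
  let _ := E.hg.setCommMonoid E.hmul_comm
  rw [E.hg.cofactor_eq_prod E.hmul_comm]
  refine Finset.prod_mul_distrib.symm.trans (Finset.prod_congr rfl fun j _ => ?_)
  exact E.gen_smul_gen j

theorem exists_mem_cofactor {r : Fin E.n → H} (hr : ∀ i, r i ∈ E.hg.gen {E.q i}) {x : H}
    (hx : x ∈ E.hg.famProd r) (i : Fin E.n) :
    ∃ w ∈ E.hg.cofactor (fun i => E.hg.gen {E.q i}) i, x ∈ E.hg.hmul (r i) w := by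
  let _ := E.hg.setCommMonoid E.hmul_comm
  rw [E.hg.famProd_eq_prod E.hmul_comm, ← Finset.mul_prod_erase _ _ (Finset.mem_univ i)] at hx
  obtain ⟨_, rfl, w, hw, hx⟩ := hx
  refine ⟨w, ?_, hx⟩
  rw [E.hg.cofactor_eq_prod E.hmul_comm, E.hg.mem_prod_iff E.hmul_comm]
  exact ⟨r, fun i _ => hr i, hw⟩

theorem decomp_unique {r s : Fin E.n → H} (hr : ∀ i, r i ∈ E.hg.gen {E.q i})
    (hs : ∀ i, s i ∈ E.hg.gen {E.q i}) {x : H} (hxr : x ∈ E.hg.famProd r)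
    (hxs : x ∈ E.hg.famProd s) : r = s := by
  funext i
  obtain ⟨w, hw, hxw⟩ := E.exists_mem_cofactor hr hxr i
  obtain ⟨w', hw', hxw'⟩ := E.exists_mem_cofactor hs hxs i
  rw [E.hg.h3l, E.star_eq] at hxw
  have h : r i ∈ E.hg.smul (E.hg.smul {s i} {w'}) {w} :=
    ⟨x, by rwa [smul_singleton], w, rfl, hxw⟩
  rw [smul_assoc, smul_singleton] at h
  obtain ⟨_, rfl, d, hd, h⟩ := h
  have hdC : d ∈ E.hg.cofactor (fun i => E.hg.gen {E.q i}) i := by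
    rw [← cofactor_smul_cofactor]
    exact ⟨w', hw', w, hw, hd⟩
  have hde : d = E.hg.e := (E.inter_cofactor i).subset
    ⟨(E.hg.isClosed_gen _).star_mul_mem (hs i) (hr i) ((E.hg.h3r _ _ _).1 h), hdC⟩
  rw [hde, E.hg.idr] at h
  exact h

open Classical in
/-- The factors `e` or `q i` prescribed by a vector over `ZMod 2`. -/
noncomputable def factor (a : Fin E.n → ZMod 2) (i : Fin E.n) : H :=
  if a i = 0 then E.hg.e else E.q i

theorem factor_mem (a : Fin E.n → ZMod 2) (i : Fin E.n) : E.factor a i ∈ E.hg.gen {E.q i} := by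
  rw [gen_q, factor]
  split_ifs <;> simp

theorem exists_famProd_factor (a : Fin E.n → ZMod 2) :
    ∃ x, E.hg.famProd (E.factor a) = {x} := by
  obtain ⟨x, hx⟩ := E.hg.prod_nonempty E.hmul_comm Finset.univ (E.factor a)
  rw [← E.hg.famProd_eq_prod E.hmul_comm] at hx
  exact ⟨x, E.famProd_eq_singleton (E.factor_mem a) hx⟩

/-- The element with prescribed factors. -/
noncomputable def ofVec (a : Fin E.n → ZMod 2) : H := (E.exists_famProd_factor a).choose

theorem famProd_factor (a : Fin E.n → ZMod 2) : E.hg.famProd (E.factor a) = {E.ofVec a} :=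
  (E.exists_famProd_factor a).choose_spec

theorem ofVec_bijective : Function.Bijective E.ofVec := by
  constructor
  · intro a b h
    have hab : E.factor a = E.factor b := E.decomp_unique (E.factor_mem a) (E.factor_mem b)
      (x := E.ofVec a) (by rw [famProd_factor]; rfl) (by rw [famProd_factor, h]; rfl)
    funext i
    have hi := congrFun hab i
    have hq := (E.invol i).1
    rw [factor, factor] at hi
    rcases zmod_two_eq_zero_or_one (a i) with ha | ha <;>
      rcases zmod_two_eq_zero_or_one (b i) with hb | hb <;> simp_all [eq_comm]
  · intro x
    obtain ⟨r, hr, hx⟩ := E.exists_famProd_eq x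
    classical
    refine ⟨fun i => if r i = E.hg.e then 0 else 1, ?_⟩
    rw [← Set.singleton_eq_singleton_iff, ← famProd_factor, ← hx]
    congr 1
    funext i
    have hri := hr i
    rw [gen_q] at hri
    rcases hri with h | h
    · simp [factor, h]
    · simp [factor, show r i = E.q i from h, (E.invol i).1]

theorem ofVec_mem_hmul (a b c : Fin E.n → ZMod 2) :
    E.ofVec c ∈ E.hg.hmul (E.ofVec a) (E.ofVec b) ↔
      ∀ i, E.factor c i ∈ E.hg.hmul (E.factor a i) (E.factor b i) := by
  let _ := E.hg.setCommMonoid E.hmul_comm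
  have h : E.hg.hmul (E.ofVec a) (E.ofVec b) =
      ∏ i, E.hg.hmul (E.factor a i) (E.factor b i) := by
    rw [← smul_singleton, ← famProd_factor, ← famProd_factor,
      E.hg.famProd_eq_prod E.hmul_comm, E.hg.famProd_eq_prod E.hmul_comm]
    refine Finset.prod_mul_distrib.symm.trans (Finset.prod_congr rfl fun i _ => ?_)
    exact E.hg.smul_singleton _ _
  rw [h, E.hg.mem_prod_iff E.hmul_comm]
  simp only [← E.hg.famProd_eq_prod E.hmul_comm, Finset.mem_univ, true_imp_iff]
  constructor
  · rintro ⟨r, hr, hc⟩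
    have hrc : r = E.factor c := E.decomp_unique (fun i => (E.hg.isClosed_gen _).mul_mem
      (E.factor_mem a i) (E.factor_mem b i) (hr i)) (E.factor_mem c) hc
      (by rw [famProd_factor]; rfl)
    exact hrc ▸ hr
  · exact fun hr => ⟨_, hr, by rw [famProd_factor]; rfl⟩

theorem hmul_q_of_isThin {i : Fin E.n} (h : E.hg.IsThin (E.q i)) :
    E.hg.hmul (E.q i) (E.q i) = {E.hg.e} := by
  rwa [IsThin, star_q] at h

theorem hmul_q_of_not_isThin {i : Fin E.n} (h : ¬ E.hg.IsThin (E.q i)) :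
    E.hg.hmul (E.q i) (E.q i) = {E.hg.e, E.q i} := by
  have hsub : E.hg.hmul (E.q i) (E.q i) ⊆ {E.hg.e, E.q i} := fun z hz =>
    (E.invol i).2.mul_mem (by simp) (by simp) hz
  have he : E.hg.e ∈ E.hg.hmul (E.q i) (E.q i) := by
    have h := E.hg.e_mem_hmul_star (E.q i)
    rwa [star_q] at h
  rw [IsThin, star_q] at h
  refine hsub.antisymm (Set.insert_subset he (Set.singleton_subset_iff.2 ?_))
  by_contra hq
  refine h (Set.Subset.antisymm (fun z hz => ?_) (Set.singleton_subset_iff.2 he))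
  rcases hsub hz with h' | h'
  · exact h'
  · exact absurd ((show z = E.q i from h') ▸ hz) hq

theorem factor_mem_hmul_of_isThin {i : Fin E.n} (h : E.hg.IsThin (E.q i))
    (a b c : Fin E.n → ZMod 2) :
    E.factor c i ∈ E.hg.hmul (E.factor a i) (E.factor b i) ↔ c i = a i + b i := by
  have hq := (E.invol i).1
  have hmul := E.hmul_q_of_isThin h
  simp only [factor]
  rcases zmod_two_eq_zero_or_one (a i) with ha | ha <;>
    rcases zmod_two_eq_zero_or_one (b i) with hb | hb <;>
    rcases zmod_two_eq_zero_or_one (c i) with hc | hc <;>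
    simp [ha, hb, hc, hmul, E.hg.idl, E.hg.idr, hq, hq.symm, CharTwo.add_self_eq_zero]

theorem factor_mem_hmul_of_not_isThin {i : Fin E.n} (h : ¬ E.hg.IsThin (E.q i))
    (a b c : Fin E.n → ZMod 2) :
    E.factor c i ∈ E.hg.hmul (E.factor a i) (E.factor b i) ↔
      (c i ≠ 0 → a i ≠ 0 ∨ b i ≠ 0) ∧ (a i ≠ 0 → b i ≠ 0 ∨ c i ≠ 0) ∧
      (b i ≠ 0 → a i ≠ 0 ∨ c i ≠ 0) := by
  have hq := (E.invol i).1
  have hmul := E.hmul_q_of_not_isThin h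
  simp only [factor]
  rcases zmod_two_eq_zero_or_one (a i) with ha | ha <;>
    rcases zmod_two_eq_zero_or_one (b i) with hb | hb <;>
    rcases zmod_two_eq_zero_or_one (c i) with hc | hc <;>
    simp [ha, hb, hc, hmul, E.hg.idl, E.hg.idr, hq, hq.symm]

end EA2Data

/-- Vectors over `ZMod 2` correspond to the supports they have. -/
noncomputable def vecEquivSet (K : Type*) : (K → ZMod 2) ≃ Set K where
  toFun a := {k | a k ≠ 0}
  invFun A k := open Classical in if k ∈ A then 1 else 0
  left_inv a := by
    funext k
    rcases zmod_two_eq_zero_or_one (a k) with h | h <;> simp [h]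
  right_inv A := by
    ext k
    simp

theorem mem_vecEquivSet {K : Type*} (a : K → ZMod 2) (k : K) :
    k ∈ vecEquivSet K a ↔ a k ≠ 0 := Iff.rfl

namespace EA2Data

variable {H : Type*} (E : EA2Data H)

open Classical in
/-- The coordinates given by the decomposition of elements into involutions. -/
noncomputable def coordinates : E.hg.Coordinates
    ({i // E.hg.IsThin (E.q i)} → ZMod 2) {i // ¬ E.hg.IsThin (E.q i)} where
  equiv := ((Equiv.ofBijective _ E.ofVec_bijective).symm.trans
    (Equiv.piEquivPiSubtypeProd (fun i => E.hg.IsThin (E.q i)) _)).trans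
      ((Equiv.refl _).prodCongr (vecEquivSet _))
  mem_hmul x y z := by
    obtain ⟨a, rfl⟩ := E.ofVec_bijective.2 x
    obtain ⟨b, rfl⟩ := E.ofVec_bijective.2 y
    obtain ⟨c, rfl⟩ := E.ofVec_bijective.2 z
    have hs : ∀ a, (Equiv.ofBijective _ E.ofVec_bijective).symm (E.ofVec a) = a :=
      Equiv.ofBijective_symm_apply_apply _ _
    simp only [Equiv.trans_apply, hs, Equiv.prodCongr_apply, Prod.map, Equiv.refl_apply,
      mem_vecEquivSet, Equiv.piEquivPiSubtypeProd_apply, funext_iff, Pi.add_apply,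
      Subtype.forall, E.ofVec_mem_hmul]
    constructor
    · intro h
      refine ⟨fun i hi => (E.factor_mem_hmul_of_isThin hi a b c).1 (h i), ?_⟩
      have h' := fun i hi => (E.factor_mem_hmul_of_not_isThin (i := i) hi a b c).1 (h i)
      exact ⟨fun i hi => (h' i hi).1, fun i hi => (h' i hi).2.1, fun i hi => (h' i hi).2.2⟩
    · rintro ⟨h1, h2, h3, h4⟩ i
      by_cases hi : E.hg.IsThin (E.q i)
      · exact (E.factor_mem_hmul_of_isThin hi a b c).2 (h1 i hi)
      · exact (E.factor_mem_hmul_of_not_isThin hi a b c).2 ⟨h2 i hi, h3 i hi, h4 i hi⟩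

theorem finrank_thin_eq :
    Module.finrank (ZMod 2) ({i // E.hg.IsThin (E.q i)} → ZMod 2) = E.n - E.psharp := by
  classical
  rw [Module.finrank_fintype_fun_eq_card, psharp, Set.ncard_eq_toFinset_card']
  have h := Fintype.card_subtype_compl fun i => E.hg.IsThick (E.q i)
  simp only [Fintype.card_fin, Hypergroup.IsThick, not_not] at h
  rw [Set.toFinset_card]
  exact h

theorem dimension_eq_one {G : Set H} (hG : E.hg.IsClosed G)
    (h : E.hg.Osup G ≠ E.hg.Othin G ∧ E.hg.Othin G = {E.hg.e}) : E.hg.dimension G = 1 := by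
  obtain ⟨W, M, rfl⟩ := E.coordinates.exists_eq_box hG
  obtain ⟨rfl, hM⟩ := (E.coordinates.Osup_ne_and_Othin_eq_iff W M).1 h
  exact E.coordinates.dimension_box_of_bot hM

theorem dimension_eq_rank2 {G : Set H} (hG : E.hg.IsClosed G)
    (h : ¬(E.hg.Osup G ≠ E.hg.Othin G ∧ E.hg.Othin G = {E.hg.e})) :
    E.hg.dimension G = E.hg.rank2 G := by
  obtain ⟨W, M, rfl⟩ := E.coordinates.exists_eq_box hG
  rw [E.coordinates.Osup_ne_and_Othin_eq_iff] at h
  rw [E.coordinates.dimension_box h, E.coordinates.rank2_box]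

theorem isClosed_univ : E.hg.IsClosed Set.univ := ⟨⟨E.hg.e, trivial⟩, Set.subset_univ _⟩

theorem rank2_univ : E.hg.rank2 Set.univ = E.n - E.psharp := by
  rw [← E.coordinates.box_univ, E.coordinates.rank2_box, finrank_top, finrank_thin_eq]

end EA2Data

end HyperPaper

open HyperPaper

/-- For a closed subset G of an elementary abelian 2-hypergroup H, the
dimension of G equals 1 if O^ϑ(G) ≠ O_ϑ(G) = {e}, and equals r_2(G) otherwise; in
particular the dimension of H equals 1 if O^ϑ(H) ≠ O_ϑ(H) = {e}, and p − p♯ otherwise. -/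
theorem stmt12 {H : Type*} (E : EA2Data H) (G : Set H) (hG : E.hg.IsClosed G) :
    ((E.hg.Osup G ≠ E.hg.Othin G ∧ E.hg.Othin G = {E.hg.e}) →
        E.hg.dimension G = 1) ∧
    (¬(E.hg.Osup G ≠ E.hg.Othin G ∧ E.hg.Othin G = {E.hg.e}) →
        E.hg.dimension G = E.hg.rank2 G) ∧
    ((E.hg.Osup (Set.univ : Set H) ≠ E.hg.Othin Set.univ ∧
        E.hg.Othin (Set.univ : Set H) = {E.hg.e}) →
        E.hg.dimension (Set.univ : Set H) = 1) ∧
    (¬(E.hg.Osup (Set.univ : Set H) ≠ E.hg.Othin Set.univ ∧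
        E.hg.Othin (Set.univ : Set H) = {E.hg.e}) →
        E.hg.dimension (Set.univ : Set H) = E.n - E.psharp) := by
  refine ⟨E.dimension_eq_one hG, E.dimension_eq_rank2 hG, E.dimension_eq_one E.isClosed_univ,
    fun h => ?_⟩
  rw [E.dimension_eq_rank2 E.isClosed_univ h, E.rank2_univ]
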